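/- arXiv:2108.09421 — 4 statements merged into one kernel-verified Lean document; each statement's English description precedes it below -/
import Mathlib

section
/- For all real s > 0 and real ν with s > |ν|, the Mellin transform of the modified Bessel function K_ν satisfies ∫_0^∞ x^{s-1} K_ν(x) dx = 2^{s-2} Γ((s+ν)/2) Γ((s-ν)/2). -/
/-- Modified Bessel function of the second kind, via the integral representation
`K_ν(x) = ∫_0^∞ exp(-x cosh t) cosh(ν t) dt` (valid for `x > 0`). -/
noncomputable def besselK (ν x : ℝ) : ℝ :=
  ∫ t in Set.Ioi (0 : ℝ), Real.exp (-x * Real.cosh t) * Real.cosh (ν * t)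

open MeasureTheory in
lemma aux_gamma (a r : ℝ) (ha : 0 < a) (hr : 0 < r) :
    ∫⁻ x in Set.Ioi (0 : ℝ), ENNReal.ofReal (x ^ (a - 1) * Real.exp (-(r * x)))
      = ENNReal.ofReal ((1 / r) ^ a * Real.Gamma a) := by
  have h := Real.integral_rpow_mul_exp_neg_mul_Ioi ha hr
  have hpos : 0 < (1 / r) ^ a * Real.Gamma a :=
    mul_pos (Real.rpow_pos_of_pos (by positivity) _) (Real.Gamma_pos_of_pos ha)
  rw [← h, ofReal_integral_eq_lintegral_ofReal]
  · by_contra hc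
    rw [integral_undef hc] at h
    linarith
  · refine (ae_restrict_iff' measurableSet_Ioi).2 (Filter.Eventually.of_forall fun x hx => ?_)
    have : (0 : ℝ) < x := hx
    simp only [Pi.zero_apply]
    positivity

open MeasureTheory in
lemma aux_exp (c u : ℝ) (hc : 0 < c) (hu : 0 < u) :
    ∫⁻ t : ℝ, ENNReal.ofReal (Real.exp (c * t) * Real.exp (-(u * Real.exp (2 * t))))
      = ENNReal.ofReal (1 / 2 * u ^ (-(c / 2)) * Real.Gamma (c / 2)) := by
  have hg := aux_gamma (c / 2) 1 (by linarith) one_pos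
  have himg : (fun t : ℝ => u * Real.exp (2 * t)) '' Set.univ = Set.Ioi 0 := by
    ext y
    simp only [Set.image_univ, Set.mem_range, Set.mem_Ioi]
    constructor
    · rintro ⟨t, rfl⟩
      positivity
    · intro hy
      refine ⟨Real.log (y / u) / 2, ?_⟩
      rw [mul_div_cancel₀ _ (two_ne_zero), Real.exp_log (by positivity)]
      field_simp
  have hinj : Set.InjOn (fun t : ℝ => u * Real.exp (2 * t)) Set.univ := by
    intro a _ b _ hab
    simp only at hab
    have := Real.exp_injective (mul_left_cancel₀ hu.ne' hab)
    linarith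
  have hder : ∀ t ∈ (Set.univ : Set ℝ), HasDerivWithinAt (fun t : ℝ => u * Real.exp (2 * t))
      (u * (Real.exp (2 * t) * 2)) Set.univ t := by
    intro t _
    have h1 : HasDerivAt (fun t : ℝ => 2 * t) 2 t := by
      simpa using (hasDerivAt_id t).const_mul (2 : ℝ)
    exact (h1.exp.const_mul u).hasDerivWithinAt
  have key := lintegral_image_eq_lintegral_abs_deriv_mul MeasurableSet.univ hder hinj
    (fun x => ENNReal.ofReal (x ^ (c / 2 - 1) * Real.exp (-(1 * x))))
  rw [himg, hg] at key
  have h2 : ∀ t : ℝ, ENNReal.ofReal |u * (Real.exp (2 * t) * 2)| *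
      ENNReal.ofReal ((u * Real.exp (2 * t)) ^ (c / 2 - 1) * Real.exp (-(1 * (u * Real.exp (2 * t)))))
      = ENNReal.ofReal (2 * u ^ (c / 2)) *
        ENNReal.ofReal (Real.exp (c * t) * Real.exp (-(u * Real.exp (2 * t)))) := by
    intro t
    rw [← ENNReal.ofReal_mul (abs_nonneg _), ← ENNReal.ofReal_mul (by positivity),
      abs_of_pos (by positivity)]
    congr 1
    rw [Real.rpow_sub_one (by positivity), Real.mul_rpow hu.le (by positivity), ← Real.exp_mul]
    have : 2 * t * (c / 2) = c * t := by ring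
    rw [this, one_mul]
    field_simp
  simp only [h2, Measure.restrict_univ] at key
  rw [lintegral_const_mul _ (by fun_prop)] at key
  have hA : 0 < 2 * u ^ (c / 2) := by positivity
  have h3 : (1 / 1 : ℝ) ^ (c / 2) * Real.Gamma (c / 2) =
      (2 * u ^ (c / 2)) * (1 / 2 * u ^ (-(c / 2)) * Real.Gamma (c / 2)) := by
    rw [Real.rpow_neg hu.le]
    simp
    field_simp
  rw [h3, ENNReal.ofReal_mul hA.le] at key
  exact ((ENNReal.mul_right_inj (by simpa using hA) ENNReal.ofReal_ne_top).1 key).symm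

open MeasureTheory in
lemma aux_even (ν x : ℝ) :
    ∫⁻ t in Set.Ioi (0 : ℝ), ENNReal.ofReal (Real.exp (-x * Real.cosh t) * Real.cosh (ν * t))
     = ∫⁻ t : ℝ, ENNReal.ofReal (1 / 2 * (Real.exp (-x * Real.cosh t) * Real.exp (ν * t))) := by
  rw [← lintegral_add_compl (μ := volume) (fun t : ℝ => ENNReal.ofReal
    (1 / 2 * (Real.exp (-x * Real.cosh t) * Real.exp (ν * t))))
    (measurableSet_Ioi (a := (0 : ℝ))), Set.compl_Ioi]
  have h1 : ∫⁻ t in Set.Iic (0 : ℝ),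
      ENNReal.ofReal (1 / 2 * (Real.exp (-x * Real.cosh t) * Real.exp (ν * t)))
      = ∫⁻ t in Set.Ioi (0 : ℝ),
      ENNReal.ofReal (1 / 2 * (Real.exp (-x * Real.cosh t) * Real.exp (-(ν * t)))) := by
    have := (Measure.measurePreserving_neg (volume : Measure ℝ)).setLIntegral_comp_emb
      (MeasurableEquiv.neg ℝ).measurableEmbedding
      (fun t => ENNReal.ofReal (1 / 2 * (Real.exp (-x * Real.cosh t) * Real.exp (ν * t))))
      (Set.Ici (0 : ℝ))
    simp only [Set.image_neg_eq_neg, Set.neg_Ici, neg_zero, Real.cosh_neg, mul_neg] at this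
    rw [← setLIntegral_congr Ioi_ae_eq_Ici] at this
    simpa using this.symm
  rw [h1, ← lintegral_add_left (by fun_prop)]
  refine lintegral_congr fun t => ?_
  rw [← ENNReal.ofReal_add (by positivity) (by positivity), Real.cosh_eq (ν * t)]
  congr 1
  ring

open MeasureTheory in
lemma aux_total (s ν : ℝ) (hs : 0 < s) (hν : |ν| < s) :
    ∫⁻ x in Set.Ioi (0 : ℝ), ENNReal.ofReal (x ^ (s - 1)) *
      ∫⁻ t in Set.Ioi (0 : ℝ), ENNReal.ofReal (Real.exp (-x * Real.cosh t) * Real.cosh (ν * t))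
    = ENNReal.ofReal (2 ^ (s - 2) * Real.Gamma ((s + ν) / 2) * Real.Gamma ((s - ν) / 2)) := by
  obtain ⟨hν1, hν2⟩ := abs_lt.1 hν
  have hmeas : Measurable fun x : ℝ => x ^ (s - 1) := by fun_prop
  calc _ = ∫⁻ x in Set.Ioi (0 : ℝ), ∫⁻ t : ℝ, ENNReal.ofReal (1 / 2 * Real.exp (ν * t)) *
        ENNReal.ofReal (x ^ (s - 1) * Real.exp (-(Real.cosh t * x))) := by
        refine setLIntegral_congr_fun measurableSet_Ioi fun x hx => ?_
        have hx' : (0 : ℝ) < x := hx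
        rw [aux_even, ← lintegral_const_mul _ (by fun_prop)]
        refine lintegral_congr fun t => ?_
        rw [← ENNReal.ofReal_mul (by positivity), ← ENNReal.ofReal_mul (by positivity)]
        congr 1
        rw [show -(Real.cosh t * x) = -x * Real.cosh t by ring]
        ring
    _ = ∫⁻ t : ℝ, ∫⁻ x in Set.Ioi (0 : ℝ), ENNReal.ofReal (1 / 2 * Real.exp (ν * t)) *
        ENNReal.ofReal (x ^ (s - 1) * Real.exp (-(Real.cosh t * x))) := by
        apply lintegral_lintegral_swap
        apply Measurable.aemeasurable
        unfold Function.uncurry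
        fun_prop
    _ = ∫⁻ t : ℝ, ∫⁻ x in Set.Ioi (0 : ℝ),
        ENNReal.ofReal (1 / 2 * 2 ^ s * Real.exp ((s + ν) * t)) *
        ENNReal.ofReal (x ^ (s - 1) * Real.exp (-((Real.exp (2 * t) + 1) * x))) := by
        refine lintegral_congr fun t => ?_
        rw [lintegral_const_mul _ (by fun_prop), lintegral_const_mul _ (by fun_prop),
          aux_gamma _ _ hs (Real.cosh_pos t), aux_gamma _ _ hs (by positivity),
          ← ENNReal.ofReal_mul (by positivity), ← ENNReal.ofReal_mul (by positivity)]
        congr 1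
        have : 1 / Real.cosh t = 2 * Real.exp t * (1 / (Real.exp (2 * t) + 1)) := by
          rw [Real.cosh_eq, Real.exp_neg, show 2 * t = t + t by ring, Real.exp_add]
          have := Real.exp_pos t
          field_simp
        rw [this, Real.mul_rpow (by positivity) (by positivity),
          Real.mul_rpow (by positivity) (by positivity), ← Real.exp_mul,
          show (s + ν) * t = t * s + ν * t by ring, Real.exp_add]
        ring
    _ = ∫⁻ x in Set.Ioi (0 : ℝ), ∫⁻ t : ℝ,
        ENNReal.ofReal (1 / 2 * 2 ^ s * Real.exp ((s + ν) * t)) *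
        ENNReal.ofReal (x ^ (s - 1) * Real.exp (-((Real.exp (2 * t) + 1) * x))) := by
        apply lintegral_lintegral_swap
        apply Measurable.aemeasurable
        unfold Function.uncurry
        fun_prop
    _ = ∫⁻ x in Set.Ioi (0 : ℝ),
        ENNReal.ofReal (1 / 4 * 2 ^ s * Real.Gamma ((s + ν) / 2)) *
        ENNReal.ofReal (x ^ ((s - ν) / 2 - 1) * Real.exp (-(1 * x))) := by
        refine setLIntegral_congr_fun measurableSet_Ioi fun x hx => ?_
        have hx' : (0 : ℝ) < x := hx
        have hG : 0 < Real.Gamma ((s + ν) / 2) := Real.Gamma_pos_of_pos (by linarith)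
        have : ∀ t : ℝ, ENNReal.ofReal (1 / 2 * 2 ^ s * Real.exp ((s + ν) * t)) *
            ENNReal.ofReal (x ^ (s - 1) * Real.exp (-((Real.exp (2 * t) + 1) * x)))
            = ENNReal.ofReal (1 / 2 * 2 ^ s * x ^ (s - 1) * Real.exp (-x)) *
            ENNReal.ofReal (Real.exp ((s + ν) * t) * Real.exp (-(x * Real.exp (2 * t)))) := by
          intro t
          rw [← ENNReal.ofReal_mul (by positivity), ← ENNReal.ofReal_mul (by positivity)]
          congr 1
          rw [show -((Real.exp (2 * t) + 1) * x) = -x + -(x * Real.exp (2 * t)) by ring,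
            Real.exp_add]
          ring
        simp only [this]
        rw [lintegral_const_mul _ (by fun_prop), aux_exp _ _ (by linarith) hx',
          ← ENNReal.ofReal_mul (by positivity), ← ENNReal.ofReal_mul (by positivity)]
        congr 1
        rw [show (s - ν) / 2 - 1 = (s - 1) + (-((s + ν) / 2)) by ring, Real.rpow_add hx', one_mul]
        ring
    _ = _ := by
        have hG : 0 < Real.Gamma ((s + ν) / 2) := Real.Gamma_pos_of_pos (by linarith)
        rw [lintegral_const_mul _ (by fun_prop), aux_gamma _ _ (by linarith) one_pos,
          ← ENNReal.ofReal_mul (by positivity)]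
        congr 1
        rw [Real.rpow_sub two_pos, div_one, Real.one_rpow, Real.rpow_two]
        ring

open MeasureTheory in
theorem mellin_besselK (s ν : ℝ) (hs : 0 < s) (hν : |ν| < s) :
    ∫ x in Set.Ioi (0 : ℝ), x ^ (s - 1) * besselK ν x
      = 2 ^ (s - 2) * Real.Gamma ((s + ν) / 2) * Real.Gamma ((s - ν) / 2) := by
  obtain ⟨hν1, hν2⟩ := abs_lt.1 hν
  have hT := aux_total s ν hs hν
  have hG1 : 0 < Real.Gamma ((s + ν) / 2) := Real.Gamma_pos_of_pos (by linarith)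
  have hG2 : 0 < Real.Gamma ((s - ν) / 2) := Real.Gamma_pos_of_pos (by linarith)
  have hLm : Measurable fun x : ℝ => ∫⁻ t in Set.Ioi (0 : ℝ),
      ENNReal.ofReal (Real.exp (-x * Real.cosh t) * Real.cosh (ν * t)) := by
    apply Measurable.lintegral_prod_right
    unfold Function.uncurry
    fun_prop
  have hm : Measurable fun x : ℝ => ENNReal.ofReal (x ^ (s - 1)) *
      ∫⁻ t in Set.Ioi (0 : ℝ),
        ENNReal.ofReal (Real.exp (-x * Real.cosh t) * Real.cosh (ν * t)) := by
    exact (by fun_prop : Measurable fun x : ℝ => ENNReal.ofReal (x ^ (s - 1))).mul hLm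
  have hfin := ae_lt_top (μ := volume.restrict (Set.Ioi (0 : ℝ))) hm
    (by rw [hT]; exact ENNReal.ofReal_ne_top)
  have hI := integral_toReal hm.aemeasurable hfin
  rw [hT, ENNReal.toReal_ofReal (by positivity)] at hI
  rw [← hI]
  refine setIntegral_congr_fun measurableSet_Ioi fun x hx => ?_
  have hx' : (0 : ℝ) < x := hx
  rw [ENNReal.toReal_mul, ENNReal.toReal_ofReal (by positivity), besselK,
    integral_eq_lintegral_of_nonneg_ae]
  · exact Filter.Eventually.of_forall fun t => by
      simp only [Pi.zero_apply]
      positivity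
  · exact Measurable.aestronglyMeasurable (by fun_prop)
end

section
/- For real a > 0 with 2a > |μ| + |ν| (taking α real, α > |μ|+|ν|), the integral ∫_0^∞ x^{α-1} K_μ(x) K_ν(x) dx equals (2^{α-3}/Γ(α)) · Γ((α+μ+ν)/2) Γ((α+μ-ν)/2) Γ((α-μ+ν)/2) Γ((α-μ-ν)/2). -/
open MeasureTheory Set

/-- Substitution `x = exp w`. -/
theorem bk_exp_subst (g : ℝ → ENNReal) :
    ∫⁻ x in Ioi (0:ℝ), g x = ∫⁻ w, ENNReal.ofReal (Real.exp w) * g (Real.exp w) := by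
  have h := lintegral_image_eq_lintegral_abs_deriv_mul (s := univ) (f := Real.exp)
    (f' := Real.exp) MeasurableSet.univ
    (fun x _ => (Real.hasDerivAt_exp x).hasDerivWithinAt) Real.exp_injective.injOn g
  rw [image_univ, Real.range_exp] at h
  rw [h]
  simp [abs_of_pos (Real.exp_pos _)]

/-- Gamma integral in exponential form. -/
theorem bk_gamma (a c : ℝ) (ha : 0 < a) (hc : 0 < c) :
    ∫⁻ w, ENNReal.ofReal (Real.exp (a * w - c * Real.exp w))
      = ENNReal.ofReal (Real.Gamma a * c ^ (-a)) := by
  have key := Real.integral_rpow_mul_exp_neg_mul_Ioi ha hc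
  have hG := Real.Gamma_pos_of_pos ha
  have hint : IntegrableOn (fun x ↦ x ^ (a - 1) * Real.exp (-(c * x))) (Ioi 0) :=
    .of_integral_ne_zero (by rw [key]; positivity)
  have h2 := ofReal_integral_eq_lintegral_ofReal hint (by
    filter_upwards [ae_restrict_mem measurableSet_Ioi] with x hx
    have : (0:ℝ) < x := hx
    simp only [Pi.zero_apply]
    positivity)
  rw [key, bk_exp_subst] at h2
  have h3 : Real.Gamma a * c ^ (-a) = (1 / c) ^ a * Real.Gamma a := by
    rw [one_div, Real.inv_rpow hc.le, Real.rpow_neg hc.le, mul_comm]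
  rw [h3, h2]
  refine lintegral_congr fun w => ?_
  rw [← ENNReal.ofReal_mul (Real.exp_pos _).le, ← Real.exp_mul, ← Real.exp_add, ← Real.exp_add]
  congr 2
  ring

theorem bk_scale (f : ℝ → ENNReal) :
    ∫⁻ t, f t = 2 * ∫⁻ v, f (2 * v) := by
  have h := lintegral_image_eq_lintegral_abs_deriv_mul (s := univ) (f := fun x : ℝ => 2 * x)
    (f' := fun _ => 2) MeasurableSet.univ
    (fun x _ => HasDerivAt.hasDerivWithinAt (by simpa using (hasDerivAt_id x).const_mul (2:ℝ)))
    (fun x _ y _ h => by simpa using h) f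
  have hr : range (fun x : ℝ => 2 * x) = univ :=
    Function.Surjective.range_eq (fun y => ⟨y / 2, by ring⟩)
  rw [image_univ, hr] at h
  simp only [Measure.restrict_univ] at h
  rw [h, lintegral_const_mul' _ _ (by simp)]
  simp

theorem bk_cov (F : ℝ → ℝ → ENNReal) (hF : Measurable (Function.uncurry F)) :
    ∫⁻ t, ∫⁻ s, F t s = 2 * ∫⁻ u, ∫⁻ v, F (u + v) (u - v) := by
  have hm : Measurable (fun p : ℝ × ℝ => F (2 * p.2 + p.1) p.1) :=
    hF.comp (f := fun p : ℝ × ℝ => (2 * p.2 + p.1, p.1)) (by fun_prop)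
  have hm2 : Measurable (fun p : ℝ × ℝ => F (p.1 + p.2) (p.1 - p.2)) :=
    hF.comp (f := fun p : ℝ × ℝ => (p.1 + p.2, p.1 - p.2)) (by fun_prop)
  calc ∫⁻ t, ∫⁻ s, F t s = ∫⁻ s, ∫⁻ t, F t s := lintegral_lintegral_swap hF.aemeasurable
    _ = ∫⁻ s, 2 * ∫⁻ v, F (2 * v + s) s := by
        refine lintegral_congr fun s => ?_
        rw [← lintegral_add_right_eq_self _ s, bk_scale]
    _ = 2 * ∫⁻ s, ∫⁻ v, F (2 * v + s) s := lintegral_const_mul' _ _ (by simp)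
    _ = 2 * ∫⁻ v, ∫⁻ s, F (2 * v + s) s := by
        rw [lintegral_lintegral_swap hm.aemeasurable]
    _ = 2 * ∫⁻ v, ∫⁻ u, F (u + v) (u - v) := by
        congr 1
        refine lintegral_congr fun v => ?_
        rw [← lintegral_sub_right_eq_self _ v]
        refine lintegral_congr fun u => ?_
        congr 1
        ring
    _ = 2 * ∫⁻ u, ∫⁻ v, F (u + v) (u - v) := by
        congr 1
        exact (lintegral_lintegral_swap (f := fun u v => F (u + v) (u - v)) hm2.aemeasurable).symm

theorem bk_cosh_meas (r b : ℝ) :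
    Measurable fun u : ℝ => ENNReal.ofReal (Real.cosh u ^ r * Real.exp (b * u)) := by
  have : Measurable Real.cosh := Real.continuous_cosh.measurable
  fun_prop

/-- The beta-type integral. -/
theorem bk_beta (p q : ℝ) (hp : 0 < p) (hq : 0 < q) :
    ∫⁻ u, ENNReal.ofReal (Real.cosh u ^ (-(p + q)) * Real.exp ((p - q) * u))
      = ENNReal.ofReal (Real.Gamma p * Real.Gamma q / (2 * (Real.Gamma (p + q) * 2 ^ (-(p + q))))) := by
  have hG := Real.Gamma_pos_of_pos (add_pos hp hq)
  have hGp := Real.Gamma_pos_of_pos hp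
  have hGq := Real.Gamma_pos_of_pos hq
  have h1 := bk_gamma p 1 hp one_pos
  have h2 := bk_gamma q 1 hq one_pos
  simp only [Real.one_rpow, mul_one, one_mul] at h1 h2
  have e : ENNReal.ofReal (Real.Gamma p * Real.Gamma q)
      = ENNReal.ofReal (2 * (Real.Gamma (p + q) * 2 ^ (-(p + q)))) *
        ∫⁻ u, ENNReal.ofReal (Real.cosh u ^ (-(p + q)) * Real.exp ((p - q) * u)) := by
    rw [ENNReal.ofReal_mul hGp.le, ← h1, ← h2]
    rw [← lintegral_mul_const _ (by fun_prop)]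
    have : ∀ t : ℝ, ENNReal.ofReal (Real.exp (p * t - Real.exp t)) *
        ∫⁻ s, ENNReal.ofReal (Real.exp (q * s - Real.exp s))
        = ∫⁻ s, ENNReal.ofReal (Real.exp (p * t - Real.exp t + (q * s - Real.exp s))) := by
      intro t
      rw [← lintegral_const_mul _ (by fun_prop)]
      refine lintegral_congr fun s => ?_
      rw [← ENNReal.ofReal_mul (Real.exp_pos _).le, ← Real.exp_add]
    simp_rw [this]
    rw [bk_cov _ (by unfold Function.uncurry; fun_prop), lintegral_lintegral_swap (by
      unfold Function.uncurry; fun_prop), ENNReal.ofReal_mul (by norm_num), mul_assoc]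
    simp only [ENNReal.ofReal_ofNat]
    congr 1
    rw [← lintegral_const_mul' _ _ ENNReal.ofReal_ne_top]
    refine lintegral_congr fun u => ?_
    have hc := Real.cosh_pos u
    have h3 := bk_gamma (p + q) (2 * Real.cosh u) (add_pos hp hq) (by positivity)
    calc _ = ∫⁻ w, ENNReal.ofReal (Real.exp ((p - q) * u)) *
          ENNReal.ofReal (Real.exp ((p + q) * w - 2 * Real.cosh u * Real.exp w)) := by
          refine lintegral_congr fun w => ?_
          rw [← ENNReal.ofReal_mul (Real.exp_pos _).le, ← Real.exp_add]
          congr 2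
          rw [Real.cosh_eq, sub_eq_add_neg w u, Real.exp_add w u, Real.exp_add w (-u)]
          ring
      _ = _ := by
          rw [lintegral_const_mul' _ _ (by simp), h3, ← ENNReal.ofReal_mul (Real.exp_pos _).le,
            ← ENNReal.ofReal_mul (by positivity), Real.mul_rpow (by norm_num) hc.le]
          congr 1
          ring
  have hpos : 0 < 2 * (Real.Gamma (p + q) * 2 ^ (-(p + q))) := by positivity
  rw [ENNReal.ofReal_div_of_pos hpos, e, mul_comm, ENNReal.mul_div_cancel_right]
  · exact (ENNReal.ofReal_pos.2 hpos).ne'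
  · exact ENNReal.ofReal_ne_top

theorem bk_split (f : ℝ → ENNReal) (hf : Measurable f) :
    ∫⁻ t, f t = ∫⁻ t in Ioi (0:ℝ), (f t + f (-t)) := by
  rw [lintegral_add_left hf, ← lintegral_add_compl f (measurableSet_Ioi (a := (0:ℝ)))]
  congr 1
  rw [compl_Ioi, ← restrict_Iio_eq_restrict_Iic]
  rw [← lintegral_indicator measurableSet_Iio, ← lintegral_indicator measurableSet_Ioi,
    ← lintegral_neg_eq_self]
  refine lintegral_congr fun t => ?_
  simp [indicator]

theorem bk_K (μ x : ℝ) (hx : 0 < x) :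
    ENNReal.ofReal (besselK μ x)
      = 2⁻¹ * ∫⁻ t, ENNReal.ofReal (Real.exp (μ * t - x * Real.cosh t)) := by
  have mc : Measurable Real.cosh := Real.continuous_cosh.measurable
  have hle : ∀ t ∈ Ioi (0:ℝ), ENNReal.ofReal (Real.exp (-x * Real.cosh t) * Real.cosh (μ * t))
      ≤ ENNReal.ofReal (Real.exp ((|μ| + 1) * t - x / 2 * Real.exp t)) := by
    intro t ht
    have ht : 0 < t := ht
    apply ENNReal.ofReal_le_ofReal
    have h1 : Real.cosh (μ * t) ≤ Real.exp (|μ| * t) := by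
      rw [Real.cosh_eq]
      have : Real.exp (μ * t) ≤ Real.exp (|μ| * t) :=
        Real.exp_le_exp.2 (mul_le_mul_of_nonneg_right (le_abs_self _) ht.le)
      have : Real.exp (-(μ * t)) ≤ Real.exp (|μ| * t) :=
        Real.exp_le_exp.2 (by nlinarith [neg_abs_le μ])
      linarith
    have h2 : Real.exp (-x * Real.cosh t) ≤ Real.exp (t - x / 2 * Real.exp t) := by
      apply Real.exp_le_exp.2
      rw [Real.cosh_eq]
      nlinarith [Real.exp_pos (-t)]
    calc _ ≤ Real.exp (t - x / 2 * Real.exp t) * Real.exp (|μ| * t) := by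
          gcongr
      _ = _ := by rw [← Real.exp_add]; congr 1; ring
  have hfin : ∫⁻ t in Ioi (0:ℝ), ENNReal.ofReal (Real.exp (-x * Real.cosh t) * Real.cosh (μ * t))
      < ⊤ := by
    calc _ ≤ ∫⁻ t in Ioi (0:ℝ), ENNReal.ofReal (Real.exp ((|μ| + 1) * t - x / 2 * Real.exp t)) :=
          setLIntegral_mono' measurableSet_Ioi hle
      _ ≤ ∫⁻ t, ENNReal.ofReal (Real.exp ((|μ| + 1) * t - x / 2 * Real.exp t)) :=
          setLIntegral_le_lintegral _ _
      _ < ⊤ := by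
          rw [bk_gamma _ _ (by positivity) (by positivity)]
          exact ENNReal.ofReal_lt_top
  have hK : ENNReal.ofReal (besselK μ x)
      = ∫⁻ t in Ioi (0:ℝ), ENNReal.ofReal (Real.exp (-x * Real.cosh t) * Real.cosh (μ * t)) := by
    rw [besselK, integral_eq_lintegral_of_nonneg_ae, ENNReal.ofReal_toReal hfin.ne]
    · exact Filter.Eventually.of_forall fun t => by
        have := Real.cosh_pos (μ * t)
        simp only [Pi.zero_apply]
        positivity
    · exact Measurable.aestronglyMeasurable (by fun_prop)
  rw [hK, bk_split _ (by fun_prop), ← lintegral_const_mul' _ _ (by simp)]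
  refine lintegral_congr fun t => ?_
  rw [← ENNReal.ofReal_add (Real.exp_pos _).le (Real.exp_pos _).le]
  have : (2⁻¹ : ENNReal) = ENNReal.ofReal 2⁻¹ := by
    rw [ENNReal.ofReal_inv_of_pos (by norm_num)]; simp
  rw [this, ← ENNReal.ofReal_mul (by norm_num)]
  congr 1
  rw [Real.cosh_neg, Real.cosh_eq (μ * t), sub_eq_add_neg, sub_eq_add_neg, Real.exp_add,
    Real.exp_add]
  simp only [mul_neg, neg_mul]
  ring

theorem bk_triple (α μ ν : ℝ) (hα : 0 < α) :
    ∫⁻ w, ENNReal.ofReal (Real.exp (α * w)) *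
        (∫⁻ t, ENNReal.ofReal (Real.exp (μ * t - Real.exp w * Real.cosh t))) *
        (∫⁻ s, ENNReal.ofReal (Real.exp (ν * s - Real.exp w * Real.cosh s)))
      = 2 * (ENNReal.ofReal (Real.Gamma α * 2 ^ (-α)) *
        ((∫⁻ u, ENNReal.ofReal (Real.cosh u ^ (-α) * Real.exp ((μ + ν) * u))) *
          ∫⁻ v, ENNReal.ofReal (Real.cosh v ^ (-α) * Real.exp ((μ - ν) * v)))) := by
  have mc : Measurable Real.cosh := Real.continuous_cosh.measurable
  have hG := Real.Gamma_pos_of_pos hα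
  set G : ℝ → ℝ → ℝ → ENNReal := fun w t s => ENNReal.ofReal (Real.exp
    (α * w + (μ * t - Real.exp w * Real.cosh t) + (ν * s - Real.exp w * Real.cosh s))) with hGdef
  have hGm : Measurable (fun p : ℝ × ℝ × ℝ => G p.1 p.2.1 p.2.2) := by
    simp only [hGdef]; fun_prop
  calc _ = ∫⁻ w, ∫⁻ t, ∫⁻ s, G w t s := by
        refine lintegral_congr fun w => ?_
        rw [mul_assoc, ← lintegral_mul_const _ (by fun_prop),
          ← lintegral_const_mul _ (by fun_prop)]
        refine lintegral_congr fun t => ?_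
        rw [← mul_assoc, ← lintegral_const_mul _ (by fun_prop)]
        refine lintegral_congr fun s => ?_
        rw [← ENNReal.ofReal_mul (Real.exp_pos _).le, ← ENNReal.ofReal_mul (by positivity),
          ← Real.exp_add, ← Real.exp_add]
    _ = ∫⁻ t, ∫⁻ w, ∫⁻ s, G w t s := by
        refine lintegral_lintegral_swap (Measurable.aemeasurable ?_)
        have : Measurable (fun p : (ℝ × ℝ) × ℝ => G p.1.1 p.1.2 p.2) := by
          simp only [hGdef]; fun_prop
        exact this.lintegral_prod_right'
    _ = ∫⁻ t, ∫⁻ s, ∫⁻ w, G w t s := by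
        refine lintegral_congr fun t => ?_
        refine lintegral_lintegral_swap (Measurable.aemeasurable ?_)
        simp only [hGdef, Function.uncurry_def]; fun_prop
    _ = ∫⁻ t, ∫⁻ s, ENNReal.ofReal (Real.exp (μ * t + ν * s) *
          (Real.Gamma α * (Real.cosh t + Real.cosh s) ^ (-α))) := by
        refine lintegral_congr fun t => lintegral_congr fun s => ?_
        have h1 := Real.cosh_pos t
        have h2 := Real.cosh_pos s
        rw [ENNReal.ofReal_mul (Real.exp_pos _).le, ← bk_gamma _ _ hα (by positivity),
          ← lintegral_const_mul' _ _ (by simp)]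
        refine lintegral_congr fun w => ?_
        rw [← ENNReal.ofReal_mul (Real.exp_pos _).le, ← Real.exp_add]
        simp only [hGdef]
        congr 2
        ring
    _ = 2 * ∫⁻ u, ∫⁻ v, ENNReal.ofReal (Real.exp (μ * (u + v) + ν * (u - v)) *
          (Real.Gamma α * (Real.cosh (u + v) + Real.cosh (u - v)) ^ (-α))) := by
        refine bk_cov _ ?_
        simp only [Function.uncurry_def]; fun_prop
    _ = _ := by
        congr 1
        rw [← lintegral_mul_const _ (bk_cosh_meas _ _), ← lintegral_const_mul' _ _ (by simp)]
        refine lintegral_congr fun u => ?_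
        rw [← lintegral_const_mul _ (bk_cosh_meas _ _), ← lintegral_const_mul' _ _ (by simp)]
        refine lintegral_congr fun v => ?_
        have h1 := Real.cosh_pos u
        have h2 := Real.cosh_pos v
        rw [← ENNReal.ofReal_mul (by positivity), ← ENNReal.ofReal_mul (by positivity)]
        congr 1
        have : Real.cosh (u + v) + Real.cosh (u - v) = 2 * (Real.cosh u * Real.cosh v) := by
          rw [Real.cosh_add, Real.cosh_sub]; ring
        rw [this, Real.mul_rpow (by norm_num) (by positivity), Real.mul_rpow h1.le h2.le]
        have : Real.exp (μ * (u + v) + ν * (u - v))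
            = Real.exp ((μ + ν) * u) * Real.exp ((μ - ν) * v) := by
          rw [← Real.exp_add]; congr 1; ring
        rw [this]
        ring

theorem bk_nonneg (μ x : ℝ) : 0 ≤ besselK μ x :=
  integral_nonneg fun t => by
    have := Real.cosh_pos (μ * t)
    simp only [Pi.zero_apply]
    positivity

theorem bk_meas (μ : ℝ) : Measurable (besselK μ) := by
  have mc : Measurable Real.cosh := Real.continuous_cosh.measurable
  have : Measurable (fun p : ℝ × ℝ => Real.exp (-p.1 * Real.cosh p.2) * Real.cosh (μ * p.2)) := by
    fun_prop
  exact (this.stronglyMeasurable.integral_prod_right' (ν := volume.restrict (Ioi 0))).measurable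

theorem mellin_besselK_product (α μ ν : ℝ) (hα : |μ| + |ν| < α) :
    ∫ x in Set.Ioi (0 : ℝ), x ^ (α - 1) * besselK μ x * besselK ν x
      = 2 ^ (α - 3) / Real.Gamma α
          * Real.Gamma ((α + μ + ν) / 2) * Real.Gamma ((α + μ - ν) / 2)
          * Real.Gamma ((α - μ + ν) / 2) * Real.Gamma ((α - μ - ν) / 2) := by
  obtain ⟨hm1, hm2⟩ := abs_le.1 (le_refl |μ|)
  obtain ⟨hn1, hn2⟩ := abs_le.1 (le_refl |ν|)
  have h0 : 0 < α := by linarith [abs_nonneg μ, abs_nonneg ν]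
  have p1 : 0 < (α + μ + ν) / 2 := by linarith
  have p2 : 0 < (α + μ - ν) / 2 := by linarith
  have p3 : 0 < (α - μ + ν) / 2 := by linarith
  have p4 : 0 < (α - μ - ν) / 2 := by linarith
  have g0 := Real.Gamma_pos_of_pos h0
  have g1 := Real.Gamma_pos_of_pos p1
  have g2 := Real.Gamma_pos_of_pos p2
  have g3 := Real.Gamma_pos_of_pos p3
  have g4 := Real.Gamma_pos_of_pos p4
  have hA := bk_beta _ _ p1 p4
  have hB := bk_beta _ _ p2 p3
  rw [show (α + μ + ν) / 2 + (α - μ - ν) / 2 = α by ring,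
    show (α + μ + ν) / 2 - (α - μ - ν) / 2 = μ + ν by ring] at hA
  rw [show (α + μ - ν) / 2 + (α - μ + ν) / 2 = α by ring,
    show (α + μ - ν) / 2 - (α - μ + ν) / 2 = μ - ν by ring] at hB
  have hT := bk_triple α μ ν h0
  have half : (2⁻¹ : ENNReal) = ENNReal.ofReal 2⁻¹ := by
    rw [ENNReal.ofReal_inv_of_pos (by norm_num)]; simp
  have key : ∫⁻ x in Set.Ioi (0 : ℝ), ENNReal.ofReal (x ^ (α - 1) * besselK μ x * besselK ν x)
      = ENNReal.ofReal (2 ^ (α - 3) / Real.Gamma α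
          * Real.Gamma ((α + μ + ν) / 2) * Real.Gamma ((α + μ - ν) / 2)
          * Real.Gamma ((α - μ + ν) / 2) * Real.Gamma ((α - μ - ν) / 2)) := by
    rw [bk_exp_subst]
    calc _ = ∫⁻ w, (2⁻¹ * 2⁻¹) * (ENNReal.ofReal (Real.exp (α * w)) *
        (∫⁻ t, ENNReal.ofReal (Real.exp (μ * t - Real.exp w * Real.cosh t))) *
        (∫⁻ s, ENNReal.ofReal (Real.exp (ν * s - Real.exp w * Real.cosh s)))) := by
          refine lintegral_congr fun w => ?_
          rw [ENNReal.ofReal_mul (mul_nonneg (by positivity) (bk_nonneg _ _)),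
            ENNReal.ofReal_mul (by positivity), bk_K _ _ (Real.exp_pos w),
            bk_K _ _ (Real.exp_pos w)]
          have : ENNReal.ofReal (Real.exp (α * w)) = ENNReal.ofReal (Real.exp w) *
              ENNReal.ofReal (Real.exp w ^ (α - 1)) := by
            rw [← ENNReal.ofReal_mul (by positivity), ← Real.exp_mul, ← Real.exp_add]
            congr 2
            ring
          rw [this]
          ring
      _ = _ := by
          rw [lintegral_const_mul' _ _ (by rw [half]; exact ENNReal.mul_ne_top (by simp) (by simp)),
            hT, hA, hB, half, ← ENNReal.ofReal_ofNat 2]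
          rw [← ENNReal.ofReal_mul (by positivity), ← ENNReal.ofReal_mul (by positivity),
            ← ENNReal.ofReal_mul (by positivity), ← ENNReal.ofReal_mul (by positivity),
            ← ENNReal.ofReal_mul (by positivity)]
          congr 1
          rw [Real.rpow_neg (by norm_num), Real.rpow_sub (by norm_num)]
          have : (0:ℝ) < 2 ^ α := by positivity
          norm_num
          field_simp
          norm_num
  rw [integral_eq_lintegral_of_nonneg_ae, key, ENNReal.toReal_ofReal (by positivity)]
  · filter_upwards [ae_restrict_mem measurableSet_Ioi] with x hx
    have : (0:ℝ) < x := hx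
    exact mul_nonneg (mul_nonneg (by positivity) (bk_nonneg _ _)) (bk_nonneg _ _)
  · have := bk_meas μ
    have := bk_meas ν
    exact Measurable.aestronglyMeasurable (by fun_prop)
end

section
/- For real a > 0 with 2a > 2|ν|, ∫_0^∞ x^{2a-1} K_ν(x)² dx = √π · Γ(a+ν) Γ(a-ν) Γ(a) / (4 Γ(a + 1/2)). -/
open MeasureTheory Set

/-- Change of variables on `ℝ` along a bijective differentiable map. -/
lemma bk_lintegral_sub_two_mul (s : ℝ) (g : ℝ → ENNReal) :
    ∫⁻ t, g t = 2 * ∫⁻ u, g (s - 2 * u) := by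
  have h := lintegral_image_eq_lintegral_abs_deriv_mul (s := univ) (f := fun u : ℝ => s - 2 * u)
    (f' := fun _ => -2) MeasurableSet.univ
    (fun x _ => by
      have := ((hasDerivAt_id x).const_mul 2).const_sub s
      simpa using this)
    (fun x _ y _ hxy => by simpa using hxy) g
  have himg : (fun u : ℝ => s - 2 * u) '' univ = univ := by
    rw [image_univ, range_eq_univ]
    intro t
    exact ⟨(s - t) / 2, by ring⟩
  rw [himg] at h
  simp only [Measure.restrict_univ] at h
  rw [h, ← lintegral_const_mul']
  · simp
  · simp

lemma bk_lintegral_neg (g : ℝ → ENNReal) :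
    ∫⁻ t in Iio (0 : ℝ), g t = ∫⁻ u in Ioi (0 : ℝ), g (-u) := by
  have h := lintegral_image_eq_lintegral_abs_deriv_mul (s := Ioi (0 : ℝ)) (f := fun u : ℝ => -u)
    (f' := fun _ => -1) measurableSet_Ioi
    (fun x _ => (hasDerivAt_neg x).hasDerivWithinAt)
    (fun x _ y _ hxy => by simpa using hxy) g
  simpa using h

lemma bk_rotate (F : ℝ → ℝ → ENNReal) (hF : Measurable (Function.uncurry F)) :
    ∫⁻ s, ∫⁻ t, F s t = 2 * ∫⁻ u, ∫⁻ w, F (w + u) (w - u) := by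
  calc ∫⁻ s, ∫⁻ t, F s t = ∫⁻ s, 2 * ∫⁻ u, F s (s - 2 * u) := by
        congr 1; funext s; exact bk_lintegral_sub_two_mul s (F s)
    _ = 2 * ∫⁻ s, ∫⁻ u, F s (s - 2 * u) := lintegral_const_mul' _ _ (by simp)
    _ = 2 * ∫⁻ u, ∫⁻ s, F s (s - 2 * u) := by
        rw [lintegral_lintegral_swap]
        apply Measurable.aemeasurable
        exact hF.comp (f := fun p : ℝ × ℝ => (p.1, p.1 - 2 * p.2)) (by fun_prop)
    _ = _ := by
        congr 2; funext u
        rw [← lintegral_add_right_eq_self _ u]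
        congr 1; funext w
        congr 1; ring

lemma bk_gamma_s11 (p b : ℝ) (hp : 0 < p) (hb : 0 < b) :
    ∫⁻ x in Ioi (0 : ℝ), ENNReal.ofReal (x ^ (p - 1) * Real.exp (-(b * x)))
      = ENNReal.ofReal ((1 / b) ^ p * Real.Gamma p) := by
  have key := Real.integral_rpow_mul_exp_neg_mul_Ioi hp hb
  have hG := Real.Gamma_pos_of_pos hp
  have hint : IntegrableOn (fun x : ℝ ↦ x ^ (p - 1) * Real.exp (-(b * x))) (Ioi 0) :=
    .of_integral_ne_zero (by rw [key]; positivity)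
  rw [← key, ofReal_integral_eq_lintegral_ofReal hint]
  filter_upwards [ae_restrict_mem measurableSet_Ioi] with x hx
  have : 0 < x := hx
  simp only [Pi.zero_apply]
  positivity

lemma bk_gamma_exp (p b : ℝ) (hp : 0 < p) (hb : 0 < b) :
    ∫⁻ w : ℝ, ENNReal.ofReal (Real.exp (p * w - b * Real.exp w))
      = ENNReal.ofReal ((1 / b) ^ p * Real.Gamma p) := by
  rw [← bk_gamma_s11 p b hp hb]
  have h := lintegral_image_eq_lintegral_abs_deriv_mul (s := univ) (f := Real.exp)
    (f' := Real.exp) MeasurableSet.univ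
    (fun x _ => (Real.hasDerivAt_exp x).hasDerivWithinAt)
    (Real.exp_injective.injOn) (fun x => ENNReal.ofReal (x ^ (p - 1) * Real.exp (-(b * x))))
  rw [image_univ, Real.range_exp] at h
  rw [h, Measure.restrict_univ]
  congr 1; funext w
  rw [← ENNReal.ofReal_mul (abs_nonneg _), abs_of_pos (Real.exp_pos w), ← Real.exp_mul,
    ← Real.exp_add, ← Real.exp_add]
  congr 2; ring

/-- `∫ (2 cosh u)^{-2a} e^{2νu} du`. -/
noncomputable def bkJ (a ν : ℝ) : ENNReal :=
  ∫⁻ u : ℝ, ENNReal.ofReal ((1 / (2 * Real.cosh u)) ^ (2 * a) * Real.exp (2 * ν * u))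

lemma bkJ_eq (a ν : ℝ) (ha : |ν| < a) :
    2 * ENNReal.ofReal (Real.Gamma (2 * a)) * bkJ a ν
      = ENNReal.ofReal (Real.Gamma (a + ν) * Real.Gamma (a - ν)) := by
  have h1 : 0 < a + ν := by linarith [neg_abs_le ν]
  have h2 : 0 < a - ν := by linarith [le_abs_self ν]
  have ha0 : 0 < 2 * a := by linarith
  have g1 := bk_gamma_exp (a + ν) 1 h1 one_pos
  have g2 := bk_gamma_exp (a - ν) 1 h2 one_pos
  simp only [div_one, Real.one_rpow, one_mul] at g1 g2
  rw [ENNReal.ofReal_mul (Real.Gamma_pos_of_pos h1).le, ← g1, ← g2,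
    ← lintegral_lintegral_mul (by fun_prop) (by fun_prop), bk_rotate _ (by fun_prop), mul_assoc]
  congr 1
  rw [bkJ, ← lintegral_const_mul' _ _ (by simp)]
  congr 1; funext u
  have hc := Real.cosh_pos u
  have : ∀ w : ℝ, ENNReal.ofReal (Real.exp ((a + ν) * (w + u) - Real.exp (w + u)))
      * ENNReal.ofReal (Real.exp ((a - ν) * (w - u) - Real.exp (w - u)))
      = ENNReal.ofReal (Real.exp (2 * ν * u)) *
        ENNReal.ofReal (Real.exp ((2 * a) * w - (2 * Real.cosh u) * Real.exp w)) := by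
    intro w
    rw [← ENNReal.ofReal_mul (Real.exp_pos _).le, ← ENNReal.ofReal_mul (Real.exp_pos _).le,
      ← Real.exp_add, ← Real.exp_add, Real.cosh_eq, sub_eq_add_neg w u, Real.exp_add w u,
      Real.exp_add w (-u)]
    congr 2; ring
  simp_rw [this]
  rw [lintegral_const_mul' _ _ (by simp), bk_gamma_exp _ _ ha0 (by positivity),
    ← ENNReal.ofReal_mul (Real.Gamma_pos_of_pos ha0).le, ← ENNReal.ofReal_mul (Real.exp_pos _).le]
  congr 1; ring

/-- The `[0,∞]`-valued Bessel function. -/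
noncomputable def bkK (ν x : ℝ) : ENNReal :=
  ∫⁻ t in Ioi (0 : ℝ), ENNReal.ofReal (Real.exp (-x * Real.cosh t) * Real.cosh (ν * t))

lemma besselK_eq_toReal (ν x : ℝ) : besselK ν x = (bkK ν x).toReal := by
  rw [besselK, bkK, integral_eq_lintegral_of_nonneg_ae]
  · exact Filter.Eventually.of_forall fun t => by
      have := Real.cosh_pos (ν * t)
      simp only [Pi.zero_apply]
      positivity
  · apply Continuous.aestronglyMeasurable
    fun_prop

lemma bkK_measurable (ν : ℝ) : Measurable (bkK ν) := by
  unfold bkK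
  apply Measurable.lintegral_prod_right' (f := fun p : ℝ × ℝ =>
    ENNReal.ofReal (Real.exp (-p.1 * Real.cosh p.2) * Real.cosh (ν * p.2)))
  fun_prop

lemma bkK_line (ν x : ℝ) :
    2 * bkK ν x = ∫⁻ t : ℝ, ENNReal.ofReal (Real.exp (-x * Real.cosh t + ν * t)) := by
  rw [← lintegral_add_compl _ (measurableSet_Ioi (a := (0 : ℝ))), compl_Ioi,
    setLIntegral_congr Iio_ae_eq_Iic.symm, bk_lintegral_neg, ← lintegral_add_left (by fun_prop),
    bkK, ← lintegral_const_mul' _ _ (by simp)]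
  congr 1; funext t
  rw [← ENNReal.ofReal_add (Real.exp_pos _).le (Real.exp_pos _).le,
    show (2 : ENNReal) = ENNReal.ofReal 2 by simp, ← ENNReal.ofReal_mul (by norm_num)]
  congr 1
  rw [Real.cosh_neg, Real.exp_add, Real.exp_add, Real.cosh_eq (ν * t), mul_neg]
  ring

lemma bk_sq (ν x : ℝ) : 4 * bkK ν x ^ 2 = 2 * ∫⁻ u : ℝ, ∫⁻ w : ℝ,
    ENNReal.ofReal (Real.exp (-((2 * Real.cosh u * Real.cosh w) * x)) * Real.exp (2 * ν * w)) := by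
  have : 4 * bkK ν x ^ 2 = (2 * bkK ν x) * (2 * bkK ν x) := by ring
  rw [this, bkK_line, ← lintegral_lintegral_mul (by fun_prop) (by fun_prop),
    bk_rotate _ (by fun_prop)]
  congr 2; funext u
  congr 1; funext w
  rw [← ENNReal.ofReal_mul (Real.exp_pos _).le, ← Real.exp_add, ← Real.exp_add, Real.cosh_add,
    Real.cosh_sub]
  congr 2; ring

lemma bk_total (a ν : ℝ) (ha : 0 < a) :
    4 * ∫⁻ x in Ioi (0 : ℝ), ENNReal.ofReal (x ^ (2 * a - 1)) * bkK ν x ^ 2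
      = 2 * (ENNReal.ofReal (Real.Gamma (2 * a) * 2 ^ (2 * a)) * (bkJ a 0 * bkJ a ν)) := by
  have ha2 : 0 < 2 * a := by linarith
  have hG := Real.Gamma_pos_of_pos ha2
  rw [← lintegral_const_mul' _ _ (by simp)]
  calc _ = ∫⁻ x in Ioi (0 : ℝ), 2 * ∫⁻ u : ℝ, ∫⁻ w : ℝ, ENNReal.ofReal (x ^ (2 * a - 1) *
        Real.exp (-((2 * Real.cosh u * Real.cosh w) * x))) *
          ENNReal.ofReal (Real.exp (2 * ν * w)) := by
        refine setLIntegral_congr_fun measurableSet_Ioi fun x hx => ?_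
        have hx0 : 0 < x := hx
        rw [mul_left_comm, bk_sq, mul_left_comm, ← lintegral_const_mul' _ _ (by simp)]
        congr 2; funext u
        rw [← lintegral_const_mul' _ _ (by simp)]
        congr 1; funext w
        rw [← ENNReal.ofReal_mul (by positivity), ← ENNReal.ofReal_mul (by positivity)]
        congr 1; ring
    _ = 2 * ∫⁻ u : ℝ, ∫⁻ w : ℝ, ∫⁻ x in Ioi (0 : ℝ), ENNReal.ofReal (x ^ (2 * a - 1) *
        Real.exp (-((2 * Real.cosh u * Real.cosh w) * x))) *
          ENNReal.ofReal (Real.exp (2 * ν * w)) := by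
        rw [lintegral_const_mul' _ _ (by simp), lintegral_lintegral_swap]
        · congr 2; funext u
          rw [lintegral_lintegral_swap]
          apply Measurable.aemeasurable
          simp only [Function.uncurry_def]
          fun_prop
        · apply Measurable.aemeasurable
          simp only [Function.uncurry_def]
          apply Measurable.lintegral_prod_right' (f := fun p : (ℝ × ℝ) × ℝ =>
            ENNReal.ofReal (p.1.1 ^ (2 * a - 1) *
            Real.exp (-((2 * Real.cosh p.1.2 * Real.cosh p.2) * p.1.1))) *
            ENNReal.ofReal (Real.exp (2 * ν * p.2)))
          fun_prop
    _ = _ := by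
        rw [bkJ, bkJ, ← lintegral_lintegral_mul (by fun_prop) (by fun_prop),
          ← lintegral_const_mul' (ENNReal.ofReal (Real.Gamma (2 * a) * 2 ^ (2 * a))) _ (by simp)]
        congr 2; funext u
        rw [← lintegral_const_mul' _ _ (by simp)]
        congr 1; funext w
        have hu := Real.cosh_pos u
        have hw := Real.cosh_pos w
        rw [lintegral_mul_const' _ _ (by simp), bk_gamma_s11 _ _ ha2 (by positivity),
          ← ENNReal.ofReal_mul (by positivity), ← ENNReal.ofReal_mul (by positivity),
          ← ENNReal.ofReal_mul (by positivity)]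
        congr 1
        have : 1 / (2 * Real.cosh u * Real.cosh w)
            = 2 * (1 / (2 * Real.cosh u)) * (1 / (2 * Real.cosh w)) := by
          field_simp
        rw [this, Real.mul_rpow (by positivity) (by positivity),
          Real.mul_rpow (by positivity) (by positivity)]
        simp
        ring

theorem mellin_besselK_square (a ν : ℝ) (ha : |ν| < a) :
    ∫ x in Set.Ioi (0 : ℝ), x ^ (2 * a - 1) * besselK ν x ^ 2
      = Real.sqrt Real.pi * Real.Gamma (a + ν) * Real.Gamma (a - ν) * Real.Gamma a
          / (4 * Real.Gamma (a + 1 / 2)) := by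
  have ha0 : 0 < a := lt_of_le_of_lt (abs_nonneg ν) ha
  have h1 := Real.Gamma_pos_of_pos (show 0 < a + ν by linarith [neg_abs_le ν])
  have h2 := Real.Gamma_pos_of_pos (show 0 < a - ν by linarith [le_abs_self ν])
  have hG := Real.Gamma_pos_of_pos (show 0 < 2 * a by linarith)
  have hGa := Real.Gamma_pos_of_pos ha0
  have hGh := Real.Gamma_pos_of_pos (show 0 < a + 1 / 2 by linarith)
  have hJν := bkJ_eq a ν ha
  have hJ0 := bkJ_eq a 0 (by simpa using ha0)
  have htot := bk_total a ν ha0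
  set T := ∫⁻ x in Ioi (0 : ℝ), ENNReal.ofReal (x ^ (2 * a - 1)) * bkK ν x ^ 2 with hT
  have hfin : ∀ ν', 2 * ENNReal.ofReal (Real.Gamma (2 * a)) * bkJ a ν' ≠ ⊤ → bkJ a ν' ≠ ⊤ := by
    intro ν' h h'
    apply h
    rw [h', ENNReal.mul_top]
    simp [hG]
  have fν := hfin ν (by rw [hJν]; simp)
  have f0 := hfin 0 (by rw [hJ0]; simp)
  have hTfin : T ≠ ⊤ := by
    intro h
    rw [h, ENNReal.mul_top (by simp)] at htot
    exact (ENNReal.mul_ne_top (by simp) (ENNReal.mul_ne_top (by simp)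
      (ENNReal.mul_ne_top f0 fν))) htot.symm
  have hmeas : Measurable fun x : ℝ => ENNReal.ofReal (x ^ (2 * a - 1)) * bkK ν x ^ 2 := by
    have := bkK_measurable ν
    fun_prop
  have hint : ∫ x in Set.Ioi (0 : ℝ), x ^ (2 * a - 1) * besselK ν x ^ 2 = T.toReal := by
    rw [hT, ← integral_toReal hmeas.aemeasurable (ae_lt_top hmeas hTfin)]
    refine setIntegral_congr_fun measurableSet_Ioi fun x hx => ?_
    have hx0 : 0 < x := hx
    rw [ENNReal.toReal_mul, ENNReal.toReal_pow, besselK_eq_toReal,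
      ENNReal.toReal_ofReal (by positivity)]
  rw [hint]
  have e1 := congrArg ENNReal.toReal hJν
  have e2 := congrArg ENNReal.toReal hJ0
  have e3 := congrArg ENNReal.toReal htot
  rw [ENNReal.toReal_ofReal (by positivity)] at e1
  rw [add_zero, sub_zero, ENNReal.toReal_ofReal (by positivity)] at e2
  simp only [ENNReal.toReal_mul, ENNReal.toReal_ofReal hG.le, ENNReal.toReal_ofNat] at e1 e2 e3
  rw [ENNReal.toReal_ofReal (by positivity)] at e3
  have hdup := Real.Gamma_mul_Gamma_add_half a
  have h2a : (2 : ℝ) ^ (1 - 2 * a) * 2 ^ (2 * a) = 2 := by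
    rw [← Real.rpow_add (by norm_num)]; simp
  generalize (bkJ a ν).toReal = X at *
  generalize (bkJ a 0).toReal = Y at *
  generalize (2 : ℝ) ^ (2 * a) = P at *
  generalize (2 : ℝ) ^ (1 - 2 * a) = Q at *
  rw [eq_div_iff (by positivity)]
  have e4 : 8 * Real.Gamma (2 * a) * T.toReal
      = P * (Real.Gamma (a + ν) * Real.Gamma (a - ν)) * (Real.Gamma a * Real.Gamma a) := by
    rw [← e1, ← e2]
    linear_combination 2 * Real.Gamma (2 * a) * e3
  have hne : 2 * Real.Gamma (2 * a) ≠ 0 := by positivity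
  apply mul_left_cancel₀ hne
  linear_combination Real.Gamma (a + 1 / 2) * e4
    + P * Real.Gamma (a + ν) * Real.Gamma (a - ν) * Real.Gamma a * hdup
    + Real.Gamma (a + ν) * Real.Gamma (a - ν) * Real.Gamma a * Real.Gamma (2 * a)
      * Real.sqrt Real.pi * h2a
end

section
/- For real b with 0 < b < 1 and real ν with 0 < |ν| < 1, ∫_0^∞ e^{-x} K_ν(bx) dx = (π / (2 b^ν sin(πν))) · [((1+√(1-b²))^ν − (1−√(1-b²))^ν) / √(1-b²)]. -/
section helpers
open MeasureTheory Set

theorem aux_stieltjes (ν q : ℝ) (h1 : -1 < ν) (h0 : ν < 0) (hq : 0 < q) :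
    IntegrableOn (fun u : ℝ => u ^ ν / (u + q)) (Ioi 0) ∧
    ∫ u in Ioi (0 : ℝ), u ^ ν / (u + q) = -Real.pi / Real.sin (Real.pi * ν) * q ^ ν := by
  set f : ℝ → ℝ → ℝ := fun x u => u ^ ν * Real.exp (-(x * u)) * Real.exp (-(q * x)) with hf
  have hu : ∀ x ∈ Ioi (0 : ℝ), ∫ u in Ioi (0 : ℝ), f x u
      = Real.Gamma (ν + 1) * (x ^ (-ν - 1) * Real.exp (-(q * x))) := by
    intro x hx
    have hx' : 0 < x := hx
    have := Real.integral_rpow_mul_exp_neg_mul_Ioi (a := ν + 1) (r := x) (by linarith) hx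
    simp only [add_sub_cancel_right] at this
    simp only [hf]
    rw [integral_mul_const, this, one_div, Real.inv_rpow hx'.le, ← Real.rpow_neg hx'.le,
      show -(ν + 1) = -ν - 1 by ring]
    ring
  have hI : ∀ x ∈ Ioi (0 : ℝ), IntegrableOn (f x) (Ioi 0) := by
    intro x hx
    have := integrableOn_rpow_mul_exp_neg_mul_rpow (p := 1) (s := ν) (b := x) h1 one_pos hx
    simp only [Real.rpow_one] at this
    have := Integrable.mul_const this (Real.exp (-(q * x)))
    simpa [hf, IntegrableOn] using this
  have hG : IntegrableOn (fun x : ℝ => Real.Gamma (ν + 1) * (x ^ (-ν - 1) * Real.exp (-(q * x))))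
      (Ioi 0) := by
    have := integrableOn_rpow_mul_exp_neg_mul_rpow (p := 1) (s := -ν - 1) (b := q)
      (by linarith) one_pos hq
    simp only [Real.rpow_one] at this
    have := Integrable.const_mul this (Real.Gamma (ν + 1))
    simpa [IntegrableOn] using this
  have hm : Measurable (Function.uncurry f) := by
    simp only [hf, Function.uncurry_def]
    fun_prop
  have hP : Integrable (Function.uncurry f)
      ((volume.restrict (Ioi 0)).prod (volume.restrict (Ioi 0))) := by
    rw [integrable_prod_iff hm.aestronglyMeasurable]
    constructor
    · filter_upwards [ae_restrict_mem measurableSet_Ioi] with x hx using hI x hx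
    · refine Integrable.congr hG ?_
      filter_upwards [ae_restrict_mem measurableSet_Ioi] with x hx
      rw [← hu x hx]
      refine setIntegral_congr_fun measurableSet_Ioi fun u hu' => ?_
      have hu0 : (0 : ℝ) < u := hu'
      simp only [Function.uncurry, hf]
      rw [Real.norm_of_nonneg (by positivity)]
  have hx : ∀ u ∈ Ioi (0 : ℝ), ∫ x in Ioi (0 : ℝ), f x u = u ^ ν / (u + q) := by
    intro u hu'
    have hu0 : (0 : ℝ) < u := hu'
    have := integral_exp_mul_Ioi (a := -(u + q)) (by linarith) 0
    have e : ∀ x, f x u = u ^ ν * Real.exp (-(u + q) * x) := by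
      intro x
      simp only [hf]
      rw [mul_assoc, ← Real.exp_add]
      ring_nf
    simp only [e]
    rw [integral_const_mul, this]
    simp only [mul_zero, Real.exp_zero, neg_div_neg_eq, mul_one_div]
  refine ⟨?_, ?_⟩
  · refine Integrable.congr hP.integral_prod_right ?_
    filter_upwards [ae_restrict_mem measurableSet_Ioi] with u hu' using hx u hu'
  · rw [← setIntegral_congr_fun measurableSet_Ioi hx, ← integral_integral_swap hP,
      setIntegral_congr_fun measurableSet_Ioi hu, integral_const_mul,
      Real.integral_rpow_mul_exp_neg_mul_Ioi (a := -ν) (r := q) (by linarith) hq,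
      one_div, Real.inv_rpow hq.le, ← Real.rpow_neg hq.le, neg_neg]
    have := Real.Gamma_mul_Gamma_one_sub (ν + 1)
    rw [show 1 - (ν + 1) = -ν by ring, mul_add, mul_one, Real.sin_add_pi] at this
    rw [mul_comm (q ^ ν), ← mul_assoc, this, div_neg, neg_div]

theorem aux_main (b ν : ℝ) (hb : 0 < b) (hb' : b < 1) (h1 : -1 < ν) (h0 : ν < 0) :
    ∫ x in Ioi (0 : ℝ), Real.exp (-x) * besselK ν (b * x)
      = Real.pi / (2 * b ^ ν * Real.sin (Real.pi * ν))
          * (((1 + Real.sqrt (1 - b ^ 2)) ^ ν - (1 - Real.sqrt (1 - b ^ 2)) ^ ν)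
              / Real.sqrt (1 - b ^ 2)) := by
  set s := Real.sqrt (1 - b ^ 2) with hs
  have hs2 : s ^ 2 = 1 - b ^ 2 := Real.sq_sqrt (by nlinarith)
  have hs0 : 0 < s := Real.sqrt_pos.2 (by nlinarith)
  have hs1 : s < 1 := by nlinarith
  have hp : 0 < (1 + s) / b := by positivity
  have hq : 0 < (1 - s) / b := div_pos (by linarith) hb
  obtain ⟨ip, vp⟩ := aux_stieltjes ν _ h1 h0 hp
  obtain ⟨iq, vq⟩ := aux_stieltjes ν _ h1 h0 hq
  set F : ℝ → ℝ := fun u => (1 / s) * (u ^ ν / (u + (1 - s) / b) - u ^ ν / (u + (1 + s) / b))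
    with hF
  have iF : IntegrableOn F (Ioi 0) := (Integrable.sub iq ip).const_mul _
  have vF : ∫ u in Ioi (0 : ℝ), F u
      = (1 / s) * (-Real.pi / Real.sin (Real.pi * ν) * ((1 - s) / b) ^ ν
        - -Real.pi / Real.sin (Real.pi * ν) * ((1 + s) / b) ^ ν) := by
    simp only [hF]
    rw [integral_const_mul, integral_sub iq ip, vp, vq]
  set g : ℝ → ℝ := fun t => Real.exp (ν * t) / (1 + b * Real.cosh t) with hg
  have hgF : ∀ t, |Real.exp t| • F (Real.exp t) = g t := by
    intro t
    have ht := Real.exp_pos t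
    have e1 : Real.exp t ^ ν = Real.exp (ν * t) := by
      rw [← Real.exp_mul, mul_comm]
    have e2 : Real.cosh t = (Real.exp t + (Real.exp t)⁻¹) / 2 := by
      rw [Real.cosh_eq, Real.exp_neg]
    simp only [hF, hg, smul_eq_mul, abs_of_pos ht, e1, e2]
    generalize Real.exp t = u at *
    have n1 : b * u + (1 - s) ≠ 0 := by nlinarith [mul_pos hb ht]
    have n2 : b * u + (1 + s) ≠ 0 := by nlinarith [mul_pos hb ht]
    have n1' : u + (1 - s) / b ≠ 0 := by positivity
    have n2' : u + (1 + s) / b ≠ 0 := by positivity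
    have n3 : 1 + b * ((u + u⁻¹) / 2) ≠ 0 := by positivity
    have k1 : 1 / (u + (1 - s) / b) - 1 / (u + (1 + s) / b)
        = s * (u⁻¹ / (1 + b * ((u + u⁻¹) / 2))) := by
      have : (u + (1 - s) / b) * (u + (1 + s) / b) = (2 * u / b) * (1 + b * ((u + u⁻¹) / 2)) := by
        field_simp
        linear_combination -hs2
      rw [div_sub_div _ _ n1' n2', this]
      field_simp
      ring
    calc _ = u * (1 / s) * Real.exp (ν * t) *
          (1 / (u + (1 - s) / b) - 1 / (u + (1 + s) / b)) := by ring
      _ = (u * u⁻¹) * (1 / s * s) * (Real.exp (ν * t) / (1 + b * ((u + u⁻¹) / 2))) := by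
          rw [k1]; ring
      _ = _ := by
          rw [mul_inv_cancel₀ ht.ne', one_div, inv_mul_cancel₀ hs0.ne']; ring
  have hder : ∀ x ∈ (univ : Set ℝ), HasDerivWithinAt Real.exp (Real.exp x) univ x :=
    fun x _ => (Real.hasDerivAt_exp x).hasDerivWithinAt
  have himg : Real.exp '' univ = Ioi 0 := by rw [image_univ, Real.range_exp]
  have ig : Integrable g := by
    have := (integrableOn_image_iff_integrableOn_abs_deriv_smul MeasurableSet.univ hder
      Real.exp_injective.injOn F).1 (himg ▸ iF)
    simp only [hgF] at this
    simpa using this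
  have vg : ∫ t, g t = ∫ u in Ioi (0 : ℝ), F u := by
    have := integral_image_eq_integral_abs_deriv_smul MeasurableSet.univ hder
      Real.exp_injective.injOn F
    rw [himg] at this
    simp only [hgF] at this
    rw [this, setIntegral_univ]
  set h : ℝ → ℝ := fun t => Real.cosh (ν * t) / (1 + b * Real.cosh t) with hh
  have hhg : ∀ t, h t = (1 / 2) * (g t + g (-t)) := by
    intro t
    simp only [hh, hg, Real.cosh_neg, Real.cosh_eq (ν * t), mul_neg]
    ring
  have ih : Integrable h := by
    have := (ig.add ig.comp_neg).const_mul (1 / 2)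
    refine this.congr (Filter.Eventually.of_forall fun t => ?_)
    simp [hhg]
  have vh : ∫ t in Ioi (0 : ℝ), h t = (1 / 2) * ∫ t, g t := by
    have a1 := integral_comp_abs (f := h)
    have a2 : ∀ t, h |t| = h t := by
      intro t
      rcases abs_choice t with e | e <;> rw [e]
      simp [hh]
    simp only [a2] at a1
    have a3 : ∫ t, h t = ∫ t, g t := by
      simp only [hhg]
      rw [integral_const_mul, integral_add ig ig.comp_neg, integral_neg_eq_self g]
      ring
    linarith
  -- Fubini
  set k : ℝ → ℝ → ℝ := fun x t =>
    Real.exp (-x) * (Real.exp (-(b * x) * Real.cosh t) * Real.cosh (ν * t)) with hk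
  have ek : ∀ x t, k x t = Real.cosh (ν * t) * Real.exp (-(1 + b * Real.cosh t) * x) := by
    intro x t
    simp only [hk]
    rw [← mul_assoc, ← Real.exp_add]
    ring_nf
  have hpos : ∀ t, 0 < 1 + b * Real.cosh t := fun t => by
    have := Real.cosh_pos t
    positivity
  have hx : ∀ t, ∫ x in Ioi (0 : ℝ), k x t = h t := by
    intro t
    have := integral_exp_mul_Ioi (a := -(1 + b * Real.cosh t)) (by linarith [hpos t]) 0
    simp only [ek]
    rw [integral_const_mul, this, hh]
    simp only [mul_zero, Real.exp_zero, neg_div_neg_eq, mul_one_div]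
  have hm : Measurable (Function.uncurry k) := by
    simp only [hk, Function.uncurry_def]
    fun_prop
  have hP : Integrable (Function.uncurry k)
      ((volume.restrict (Ioi 0)).prod (volume.restrict (Ioi 0))) := by
    rw [integrable_prod_iff' hm.aestronglyMeasurable]
    constructor
    · refine Filter.Eventually.of_forall fun t => ?_
      simp only [Function.uncurry, ek]
      exact Integrable.const_mul
        (integrableOn_exp_mul_Ioi (a := -(1 + b * Real.cosh t)) (by linarith [hpos t]) 0) _
    · refine Integrable.congr ih.integrableOn (Filter.Eventually.of_forall fun t => ?_)
      simp only []
      rw [← hx t]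
      congr 1
      ext x
      have := Real.cosh_pos (ν * t)
      simp only [Function.uncurry, hk]
      rw [Real.norm_of_nonneg (by positivity)]
  have hL : ∫ x in Ioi (0 : ℝ), Real.exp (-x) * besselK ν (b * x) = ∫ t in Ioi (0 : ℝ), h t := by
    simp only [← hx]
    rw [← integral_integral_swap hP]
    simp only [hk, integral_const_mul, besselK]
  rw [hL, vh, vg, vF, Real.div_rpow (by linarith) hb.le, Real.div_rpow (by linarith) hb.le]
  have hbν : b ^ ν ≠ 0 := (Real.rpow_pos_of_pos hb ν).ne'
  have hsin : Real.sin (Real.pi * ν) ≠ 0 := by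
    have := Real.sin_neg_of_neg_of_neg_pi_lt (x := Real.pi * ν)
      (by nlinarith [Real.pi_pos]) (by nlinarith [Real.pi_pos])
    exact this.ne
  field_simp
  ring

end helpers

theorem integral_exp_besselK_scaled (b ν : ℝ) (hb : 0 < b) (hb' : b < 1)
    (hν : 0 < |ν|) (hν' : |ν| < 1) :
    ∫ x in Set.Ioi (0 : ℝ), Real.exp (-x) * besselK ν (b * x)
      = Real.pi / (2 * b ^ ν * Real.sin (Real.pi * ν))
          * (((1 + Real.sqrt (1 - b ^ 2)) ^ ν - (1 - Real.sqrt (1 - b ^ 2)) ^ ν)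
              / Real.sqrt (1 - b ^ 2)) := by
  obtain ⟨l, r⟩ := abs_lt.1 hν'
  rcases lt_or_gt_of_ne (abs_pos.1 hν) with h | h
  · exact aux_main b ν hb hb' l h
  · have key := aux_main b (-ν) hb hb' (by linarith) (by linarith)
    have e : ∀ x, besselK (-ν) x = besselK ν x := by
      intro x
      simp only [besselK, neg_mul ν, Real.cosh_neg]
    simp only [e] at key
    rw [key]
    set s := Real.sqrt (1 - b ^ 2) with hs
    have hs2 : s ^ 2 = 1 - b ^ 2 := Real.sq_sqrt (by nlinarith)
    have hs0 : 0 < s := Real.sqrt_pos.2 (by nlinarith)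
    have hs1 : s < 1 := by nlinarith
    have hA : 0 < (1 + s) ^ ν := Real.rpow_pos_of_pos (by linarith) _
    have hB : 0 < (1 - s) ^ ν := Real.rpow_pos_of_pos (by linarith) _
    have hC : 0 < b ^ ν := Real.rpow_pos_of_pos hb _
    have hAB : (1 + s) ^ ν * (1 - s) ^ ν = b ^ ν * b ^ ν := by
      rw [← Real.mul_rpow (by linarith) (by linarith), ← Real.mul_rpow hb.le hb.le]
      congr 1
      linear_combination -hs2
    have hsin : 0 < Real.sin (Real.pi * ν) :=
      Real.sin_pos_of_pos_of_lt_pi (by nlinarith [Real.pi_pos]) (by nlinarith [Real.pi_pos])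
    rw [Real.rpow_neg hb.le, Real.rpow_neg (by linarith), Real.rpow_neg (by linarith),
      mul_neg, Real.sin_neg]
    generalize (1 + s) ^ ν = A at *
    generalize (1 - s) ^ ν = B at *
    generalize b ^ ν = C at *
    have hd : A⁻¹ - B⁻¹ = (B - A) / (C * C) := by
      rw [← hAB]
      field_simp
    rw [hd]
    field_simp
    ring
end
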